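/- For a fixed Fano plane F, the map sending an orientation → on F to the associated Fano plane F_→ is a bijection from the set of orientations on F onto the set of Fano planes orthogonal to F. -/

import Mathlib

/-- A Steiner triple system: every block has 3 points and every pair of
distinct points lies in exactly one block. -/
def IsSteiner {V : Type*} [DecidableEq V] (B : Finset (Finset V)) : Prop :=
  (∀ b ∈ B, b.card = 3) ∧
  ∀ x y : V, x ≠ y → ∃! b : Finset V, b ∈ B ∧ x ∈ b ∧ y ∈ b

/-- A Fano plane: a Steiner triple system on a 7-point set. -/
def IsFano {V : Type*} [DecidableEq V] [Fintype V] (B : Finset (Finset V)) : Prop :=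
  Fintype.card V = 7 ∧ IsSteiner B

/-- Two systems on the same point set are disjoint if they share no block. -/
def DisjointSTS {V : Type*} [DecidableEq V] (B1 B2 : Finset (Finset V)) : Prop :=
  ∀ b : Finset V, ¬ (b ∈ B1 ∧ b ∈ B2)

/-- Orthogonality of two Steiner triple systems: disjoint, and two distinct
pairs lying in blocks of the first system with a common third point never have
the same third point in the second system. -/
def OrthogonalSTS {V : Type*} [DecidableEq V] (B1 B2 : Finset (Finset V)) : Prop :=
  DisjointSTS B1 B2 ∧
  ∀ x y z u v a b : V, ({x, y} : Finset V) ≠ ({u, v} : Finset V) →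
    ({x, y, z} : Finset V) ∈ B1 → ({u, v, z} : Finset V) ∈ B1 →
    ({x, y, a} : Finset V) ∈ B2 → ({u, v, b} : Finset V) ∈ B2 → a ≠ b

/-- An orientation on a Fano plane `B`: an antisymmetric relation that cyclically
orients every block, and such that for every point `x` the three out-neighbors of
`x` on the three blocks through `x` themselves form a block. -/
def IsOrientation {V : Type*} [DecidableEq V] (B : Finset (Finset V)) (r : V → V → Prop) : Prop :=
  (∀ x y : V, r x y → ¬ r y x) ∧
  (∀ x1 x2 x3 : V, ({x1, x2, x3} : Finset V) ∈ B →
    (r x1 x2 ∧ r x2 x3 ∧ r x3 x1) ∨ (r x1 x3 ∧ r x3 x2 ∧ r x2 x1)) ∧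
  (∀ x y1 z1 y2 z2 y3 z3 : V,
    ({x, y1, z1} : Finset V) ∈ B → ({x, y2, z2} : Finset V) ∈ B → ({x, y3, z3} : Finset V) ∈ B →
    ({x, y1, z1} : Finset V) ≠ ({x, y2, z2} : Finset V) →
    ({x, y1, z1} : Finset V) ≠ ({x, y3, z3} : Finset V) →
    ({x, y2, z2} : Finset V) ≠ ({x, y3, z3} : Finset V) →
    r x y1 → r x y2 → r x y3 → ({y1, y2, y3} : Finset V) ∈ B)

open scoped Classical in
/-- The block family `T(v) = { x | x → v }`, `v ∈ V`, associated with an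
orientation `r` (written `F_→` in the paper). -/
noncomputable def orientBlocks {V : Type*} [DecidableEq V] [Fintype V] (r : V → V → Prop) :
    Finset (Finset V) :=
  Finset.univ.image (fun v => Finset.univ.filter (fun x => r x v))

/-- The triple `x, y, z` is a block of `B`. -/
def IsLine {V : Type*} [DecidableEq V] (B : Finset (Finset V)) (x y z : V) : Prop :=
  ({x, y, z} : Finset V) ∈ B

/-- The Paley tournament on seven points: `j - i` is a nonzero square. -/
abbrev Paley (i j : Fin 7) : Prop := j - i = 1 ∨ j - i = 2 ∨ j - i = 4

/-- The cyclic Fano plane whose blocks are the translates of the nonzero squares. -/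
abbrev CyclicLine (i j k : Fin 7) : Prop :=
  ∃ c : Fin 7, ({i, j, k} : Finset (Fin 7)) = {c + 1, c + 2, c + 4}

/-- The cyclic Fano plane whose blocks are the translates of the nonsquares. -/
abbrev CyclicLine' (i j k : Fin 7) : Prop :=
  ∃ c : Fin 7, ({i, j, k} : Finset (Fin 7)) = {c + 3, c + 5, c + 6}

section Lines

variable {V : Type*} [DecidableEq V] {B : Finset (Finset V)}

theorem IsLine.swap_left {x y z : V} (h : IsLine B x y z) : IsLine B y x z := by
  rwa [IsLine, Finset.insert_comm]

theorem IsLine.swap_right {x y z : V} (h : IsLine B x y z) : IsLine B x z y := by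
  rwa [IsLine, Finset.pair_comm]

theorem IsLine.ne (hB : IsSteiner B) {x y z : V} (h : IsLine B x y z) :
    x ≠ y ∧ x ≠ z ∧ y ≠ z := by
  grind [Finset.card_le_two, hB.1 _ h]

theorem IsLine.unique (hB : IsSteiner B) {x y z w : V} (h : IsLine B x y z)
    (h' : IsLine B x y w) : z = w := by
  have hn := h.ne hB
  have hn' := h'.ne hB
  have := (hB.2 x y hn.1).unique ⟨h, by simp, by simp⟩ ⟨h', by simp, by simp⟩
  have hz : z ∈ ({x, y, w} : Finset V) := this ▸ by simp
  grind

theorem exists_isLine (hB : IsSteiner B) {x y : V} (hxy : x ≠ y) : ∃ z, IsLine B x y z := by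
  obtain ⟨b, ⟨hb, hx, hy⟩, -⟩ := hB.2 x y hxy
  obtain ⟨z, hz⟩ : ∃ z, (b.erase x).erase y = {z} := by
    rw [← Finset.card_eq_one, Finset.card_erase_of_mem (by grind), Finset.card_erase_of_mem hx,
      hB.1 b hb]
  refine ⟨z, ?_⟩
  rwa [IsLine, ← hz, Finset.insert_erase (by grind), Finset.insert_erase hx]

theorem exists_eq_of_mem (hB : IsSteiner B) {b : Finset V} (hb : b ∈ B) :
    ∃ x y z, b = {x, y, z} ∧ IsLine B x y z := by
  obtain ⟨x, y, z, -, -, -, rfl⟩ := Finset.card_eq_three.1 (hB.1 b hb)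
  exact ⟨x, y, z, rfl, hb⟩

/-- A Steiner system containing the images of all translates of a perfect difference set has no
other line. -/
theorem isLine_iff_of_forall (hB : IsSteiner B) (E : Fin 7 ≃ V) {a b d : Fin 7}
    (hd : ∀ i j : Fin 7, i ≠ j → ∃ k c, ({i, j, k} : Finset (Fin 7)) = {c + a, c + b, c + d})
    (h : ∀ c, IsLine B (E (c + a)) (E (c + b)) (E (c + d))) (i j k : Fin 7) :
    IsLine B (E i) (E j) (E k) ↔ ∃ c, ({i, j, k} : Finset (Fin 7)) = {c + a, c + b, c + d} := by
  have key : ∀ i j k c, ({i, j, k} : Finset (Fin 7)) = {c + a, c + b, c + d} →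
      IsLine B (E i) (E j) (E k) := by
    intro i j k c hc
    have := congrArg (Finset.image E) hc
    simp only [Finset.image_insert, Finset.image_singleton] at this
    rw [IsLine, this]
    exact h c
  refine ⟨fun hl => ?_, fun ⟨c, hc⟩ => key i j k c hc⟩
  obtain ⟨k', c, hc⟩ := hd i j (fun e => (hl.ne hB).1 (congrArg E e))
  obtain rfl := E.injective (hl.unique hB (key i j k' c hc))
  exact ⟨c, hc⟩

theorem IsOrientation.isLine_of_rel (hB : IsSteiner B) {r : V → V → Prop}
    (hr : IsOrientation B r) {x a b c : V} (ha : r x a) (hb : r x b) (hc : r x c)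
    (hab : a ≠ b) (hac : a ≠ c) (hbc : b ≠ c) : IsLine B a b c := by
  obtain ⟨h1, h2, h3⟩ := hr
  have ne : ∀ {y}, r x y → x ≠ y := fun h e => h1 _ _ h (e ▸ e ▸ h)
  obtain ⟨a', ha'⟩ := exists_isLine hB (ne ha)
  obtain ⟨b', hb'⟩ := exists_isLine hB (ne hb)
  obtain ⟨c', hc'⟩ := exists_isLine hB (ne hc)
  have key : ∀ {a a' b b'}, IsLine B x a a' → r x a → r x b → a ≠ b →
      ({x, a, a'} : Finset V) ≠ {x, b, b'} := by
    intro a a' b b' hl ha hb hab e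
    have hb' : b ∈ ({x, a, a'} : Finset V) := e ▸ by simp
    simp only [Finset.mem_insert, Finset.mem_singleton] at hb'
    have := h2 x a a' hl
    have := ne hb
    grind
  exact h3 x a a' b b' c c' ha' hb' hc' (key ha' ha hb hab) (key ha' ha hc hac)
    (key hb' hb hc hbc) ha hb hc

theorem eq_of_isLine_iff {B' : Finset (Finset V)} (hB : IsSteiner B) (hB' : IsSteiner B')
    (h : ∀ x y z, IsLine B x y z ↔ IsLine B' x y z) : B = B' := by
  ext b
  constructor <;> intro hb
  · obtain ⟨x, y, z, rfl, hl⟩ := exists_eq_of_mem hB hb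
    exact (h x y z).1 hl
  · obtain ⟨x, y, z, rfl, hl⟩ := exists_eq_of_mem hB' hb
    exact (h x y z).2 hl

theorem isOrientation_of_equiv {r : V → V → Prop} (E : Fin 7 ≃ V)
    (hE : ∀ i j k, IsLine B (E i) (E j) (E k) ↔ CyclicLine i j k)
    (hr : ∀ i j, r (E i) (E j) ↔ Paley i j) : IsOrientation B r := by
  refine ⟨?_, ?_, ?_⟩
  · have : ∀ i j, Paley i j → ¬ Paley j i := by decide
    simpa [← E.forall_congr_right, hr] using this
  · have : ∀ i j k, CyclicLine i j k →
        (Paley i j ∧ Paley j k ∧ Paley k i) ∨ (Paley i k ∧ Paley k j ∧ Paley j i) := by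
      decide +kernel
    change ∀ x y z, IsLine B x y z → _
    simpa only [← E.forall_congr_right, hr, hE] using this
  · have key : ∀ x a b c, r x a → r x b → r x c →
        a ≠ b ∧ a ≠ c ∧ b ≠ c → IsLine B a b c := by
      have : ∀ i j k l, Paley i j → Paley i k → Paley i l →
          j ≠ k ∧ j ≠ l ∧ k ≠ l → CyclicLine j k l := by decide +kernel
      simpa only [← E.forall_congr_right, hr, hE, E.injective.ne_iff] using this
    have ne : ∀ x a a' b b', IsLine B x a a' → IsLine B x b b' →
        ({x, a, a'} : Finset V) ≠ {x, b, b'} → a ≠ b := by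
      rintro x a a' b b' h h' hne rfl
      have : ∀ i j k l, CyclicLine i j k → CyclicLine i j l → k = l := by decide +kernel
      have hu : ∀ x y z w, IsLine B x y z → IsLine B x y w → z = w := by
        simpa only [← E.forall_congr_right, hE, E.injective.eq_iff] using this
      exact hne (by rw [hu _ _ _ _ h h'])
    intro x a a' b b' c c' ha hb hc hab hac hbc ra rb rc
    exact key x a b c ra rb rc ⟨ne _ _ _ _ _ ha hb hab, ne _ _ _ _ _ ha hc hac,
      ne _ _ _ _ _ hb hc hbc⟩

end Lines

theorem exists_equiv_of_nodup {V : Type*} [Fintype V] (hV : Fintype.card V = 7) {a b c d e f g : V}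
    (h : [a, b, c, d, e, f, g].Nodup) :
    ∃ E : Fin 7 ≃ V, ⇑E = ![a, b, c, d, e, f, g] := by
  have hi : Function.Injective ![a, b, c, d, e, f, g] := by
    have := List.nodup_ofFn (f := ![a, b, c, d, e, f, g])
    rw [← this]
    simpa using h
  exact ⟨Equiv.ofBijective _ ((Fintype.bijective_iff_injective_and_card _).2 ⟨hi, by simp [hV]⟩),
    rfl⟩

section Coordinates

variable {V : Type*} [DecidableEq V] [Fintype V] {B B' : Finset (Finset V)}

theorem exists_notMem_of_length_lt (hV : Fintype.card V = 7) (l : List V) (hl : l.length < 7) :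
    ∃ x, x ∉ l := by
  by_contra! h
  have : (Finset.univ : Finset V) ⊆ l.toFinset := fun x _ => by simpa using h x
  have := Finset.card_le_card this
  have := l.toFinset_card_le
  rw [Finset.card_univ] at *
  omega

theorem mem_of_nodup (hV : Fintype.card V = 7) (l : List V) (hl : l.Nodup) (h7 : l.length = 7)
    (x : V) : x ∈ l := by
  by_contra h
  have : (x :: l).Nodup := List.nodup_cons.2 ⟨h, hl⟩
  have := this.length_le_card
  simp at this
  omega

theorem exists_pair_cyclicLine : ∀ i j : Fin 7, i ≠ j → ∃ k, CyclicLine i j k := by decide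

theorem exists_pair_cyclicLine' : ∀ i j : Fin 7, i ≠ j → ∃ k, CyclicLine' i j k := by decide

/-- Three lines through `x` and one transversal line determine the remaining three lines. -/
theorem IsLine.transversal (hB : IsFano B) {x a a' b b' c c' : V}
    (hn : [x, a, a', b, b', c, c'].Nodup) (ha : IsLine B x a a') (hb : IsLine B x b b')
    (hc : IsLine B x c c') (h : IsLine B a b c) : IsLine B a b' c' := by
  obtain ⟨hV, hS⟩ := hB
  have sl := @IsLine.swap_left V _ B
  have sr := @IsLine.swap_right V _ B
  have n := @IsLine.ne V _ B hS
  have u := @IsLine.unique V _ B hS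
  have mem := mem_of_nodup hV _ hn rfl
  simp only [List.nodup_cons, List.mem_cons, List.not_mem_nil, or_false, not_or] at mem hn
  obtain ⟨q, hq⟩ := exists_isLine hS (x := a) (y := b') (by grind)
  have := mem q
  have := hc.swap_right
  grind

theorem exists_transversal (hB : IsFano B) {x a a' b b' c c' : V}
    (hn : [x, a, a', b, b', c, c'].Nodup) (ha : IsLine B x a a') (hb : IsLine B x b b')
    (hc : IsLine B x c c') : IsLine B a b c ∨ IsLine B a b c' := by
  obtain ⟨hV, hS⟩ := hB
  have sl := @IsLine.swap_left V _ B
  have sr := @IsLine.swap_right V _ B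
  have n := @IsLine.ne V _ B hS
  have u := @IsLine.unique V _ B hS
  have mem := mem_of_nodup hV _ hn rfl
  simp only [List.nodup_cons, List.mem_cons, List.not_mem_nil, or_false, not_or] at mem hn
  obtain ⟨q, hq⟩ := exists_isLine hS (x := a) (y := b) (by grind)
  have := mem q
  have := hc.swap_right
  grind

/-- The blocks through a point of two disjoint Fano planes form a hexagon. -/
theorem exists_hexagon (hB : IsFano B) (hB' : IsFano B') (hd : DisjointSTS B B') :
    ∃ x p1 p2 p3 p4 p5 p6, [x, p1, p2, p3, p4, p5, p6].Nodup ∧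
      (IsLine B x p1 p2 ∧ IsLine B x p3 p4 ∧ IsLine B x p5 p6) ∧
      (IsLine B' x p2 p3 ∧ IsLine B' x p4 p5 ∧ IsLine B' x p6 p1) := by
  obtain ⟨hV, hS⟩ := hB
  obtain ⟨-, hS'⟩ := hB'
  have sl := @IsLine.swap_left V _
  have sr := @IsLine.swap_right V _
  have n := @IsLine.ne V _ B hS
  have n' := @IsLine.ne V _ B' hS'
  have u := @IsLine.unique V _ B hS
  have u' := @IsLine.unique V _ B' hS'
  have dj : ∀ x y z, IsLine B x y z → ¬ IsLine B' x y z := fun x y z h h' => hd _ ⟨h, h'⟩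
  obtain ⟨x, -⟩ := exists_notMem_of_length_lt hV [] (by simp)
  obtain ⟨p1, h1⟩ := exists_notMem_of_length_lt hV [x] (by simp)
  simp only [List.mem_singleton] at h1
  obtain ⟨p2, h2⟩ := exists_isLine hS (Ne.symm h1)
  obtain ⟨p3, h3⟩ := exists_isLine hS' (n h2).2.1
  obtain ⟨p4, h4⟩ := exists_isLine hS (n' h3).2.1
  obtain ⟨p5, h5⟩ := exists_isLine hS' (n h4).2.1
  obtain ⟨p6, h6⟩ := exists_isLine hS (n' h5).2.1
  have d31 : p3 ≠ p1 := by grind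
  have d41 : p4 ≠ p1 := by grind
  have d42 : p4 ≠ p2 := by grind
  have d52 : p5 ≠ p2 := by grind
  have d53 : p5 ≠ p3 := by grind
  have d51 : p5 ≠ p1 := by
    rintro rfl
    obtain ⟨q1, hq⟩ := exists_notMem_of_length_lt hV [x, p5, p2, p3, p4] (by simp)
    simp only [List.mem_cons, List.not_mem_nil, or_false, not_or] at hq
    obtain ⟨q2, hq2⟩ := exists_isLine hS (Ne.symm hq.1)
    obtain ⟨q3, hq3⟩ := exists_isLine hS' (Ne.symm hq.1)
    have := mem_of_nodup hV [x, p5, p2, p3, p4, q1, q2] (by simp; grind) rfl q3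
    simp only [List.mem_cons, List.not_mem_nil, or_false] at this
    grind
  have hn : [x, p1, p2, p3, p4, p5, p6].Nodup := by simp; grind
  obtain ⟨q, hq⟩ := exists_isLine hS' (n h6).2.1
  have := mem_of_nodup hV _ hn rfl q
  have hn' := hn
  simp only [List.nodup_cons, List.mem_cons, List.not_mem_nil, or_false, not_or] at this hn'
  have hq' := sr hq
  have h3' := sr h3
  have h5' := sr h5
  clear sl sr dj n u
  exact ⟨x, p1, p2, p3, p4, p5, p6, hn, ⟨h2, h4, h6⟩, h3, h5, by grind⟩

theorem exists_hexagon_transversal (hB : IsFano B) (hB' : IsFano B') (hd : DisjointSTS B B') :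
    ∃ x p1 p2 p3 p4 p5 p6, [x, p1, p2, p3, p4, p5, p6].Nodup ∧
      (IsLine B x p1 p2 ∧ IsLine B x p3 p4 ∧ IsLine B x p5 p6) ∧
      (IsLine B' x p2 p3 ∧ IsLine B' x p4 p5 ∧ IsLine B' x p6 p1) ∧
      IsLine B p1 p3 p5 ∧ IsLine B' p2 p4 p6 := by
  obtain ⟨x, p1, p2, p3, p4, p5, p6, hn, ⟨a1, a2, a3⟩, b1, b2, b3⟩ := exists_hexagon hB hB' hd
  have key : ∀ p1 p2 p3 p4 p5 p6, [x, p1, p2, p3, p4, p5, p6].Nodup → IsLine B p1 p3 p5 →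
      IsLine B' x p2 p3 → IsLine B' x p4 p5 → IsLine B' x p6 p1 → IsLine B' p2 p4 p6 := by
    intro p1 p2 p3 p4 p5 p6 hn a b1 b2 b3
    refine (exists_transversal hB' (by simp at hn ⊢; grind) b1 b2 b3).resolve_right fun h => ?_
    have := IsLine.transversal hB' (by simp at hn ⊢; grind) b3.swap_right b1 b2
      h.swap_right.swap_left
    exact hd _ ⟨a, this⟩
  rcases exists_transversal hB (by simp at hn ⊢; grind) a1 a2 a3 with h | h
  · exact ⟨x, p1, p2, p3, p4, p5, p6, hn, ⟨a1, a2, a3⟩, ⟨b1, b2, b3⟩, h,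
      key p1 p2 p3 p4 p5 p6 hn h b1 b2 b3⟩
  · have h' : IsLine B p2 p6 p4 := (IsLine.transversal hB (by simp at hn ⊢; grind) a3.swap_right
      a1 a2 h.swap_right.swap_left).swap_left
    have hn' : [x, p2, p1, p6, p5, p4, p3].Nodup := by simp at hn ⊢; grind
    exact ⟨x, p2, p1, p6, p5, p4, p3, hn', ⟨a1.swap_right, a3.swap_right, a2.swap_right⟩,
      ⟨b3.swap_right, b2.swap_right, b1.swap_right⟩, h',
      key p2 p1 p6 p5 p4 p3 hn' h' b3.swap_right b2.swap_right b1.swap_right⟩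

/-- A pair of disjoint Fano planes is isomorphic to the pair of cyclic ones. -/
theorem exists_equiv_of_disjoint (hB : IsFano B) (hB' : IsFano B') (hd : DisjointSTS B B') :
    ∃ E : Fin 7 ≃ V, (∀ i j k, IsLine B (E i) (E j) (E k) ↔ CyclicLine i j k) ∧
      ∀ i j k, IsLine B' (E i) (E j) (E k) ↔ CyclicLine' i j k := by
  obtain ⟨x, p1, p2, p3, p4, p5, p6, hn, ⟨a1, a2, a3⟩, ⟨b1, b2, b3⟩, h, h'⟩ :=
    exists_hexagon_transversal hB hB' hd
  obtain ⟨E, hE⟩ := exists_equiv_of_nodup hB.1 (a := x) (b := p1) (c := p3) (d := p2) (e := p5)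
    (f := p6) (g := p4) (by simp at hn ⊢; grind)
  have sl := @IsLine.swap_left V _
  have sr := @IsLine.swap_right V _
  refine ⟨E, isLine_iff_of_forall hB.2 E exists_pair_cyclicLine ?_,
    isLine_iff_of_forall hB'.2 E exists_pair_cyclicLine' ?_⟩
  · have h1 := IsLine.transversal hB (by simp at hn ⊢; grind) a1 a2 a3 h
    have h2 := IsLine.transversal hB (by simp at hn ⊢; grind) a2 a1 a3 h.swap_left
    have h3 := IsLine.transversal hB (by simp at hn ⊢; grind) a3 a1 a2
      h.swap_right.swap_left
    intro c
    rw [hE]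
    fin_cases c <;> simp <;> grind
  · have h1 := IsLine.transversal hB' (by simp at hn ⊢; grind) b1 b2 b3 h'
    have h2 := IsLine.transversal hB' (by simp at hn ⊢; grind) b2 b1 b3 h'.swap_left
    have h3 := IsLine.transversal hB' (by simp at hn ⊢; grind) b3 b1 b2
      h'.swap_right.swap_left
    intro c
    rw [hE]
    fin_cases c <;> simp <;> grind

theorem exists_oriented_pencil (hB : IsFano B) {r : V → V → Prop} (hr : IsOrientation B r) :
    ∃ x a a' b b' c c', [x, a, a', b, b', c, c'].Nodup ∧
      (IsLine B x a a' ∧ IsLine B x b b' ∧ IsLine B x c c') ∧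
      (r x a ∧ r a a' ∧ r a' x) ∧ (r x b ∧ r b b' ∧ r b' x) ∧ (r x c ∧ r c c' ∧ r c' x) ∧
      IsLine B a b c ∧ r a b ∧ r b c ∧ r c a := by
  obtain ⟨hV, hS⟩ := hB
  have out : ∀ {x p}, p ≠ x → ∃ a a', (p = a ∨ p = a') ∧ IsLine B x a a' ∧
      r x a ∧ r a a' ∧ r a' x := by
    intro x p hp
    obtain ⟨q, hq⟩ := exists_isLine hS hp.symm
    rcases hr.2.1 x p q hq with h | h
    · exact ⟨p, q, .inl rfl, hq, h⟩
    · exact ⟨q, p, .inr rfl, hq.swap_right, h⟩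
  obtain ⟨x, -⟩ := exists_notMem_of_length_lt hV [] (by simp)
  obtain ⟨p, hp⟩ := exists_notMem_of_length_lt hV [x] (by simp)
  simp only [List.mem_singleton] at hp
  obtain ⟨a, a', -, ha, oa⟩ := out hp
  obtain ⟨p, hp⟩ := exists_notMem_of_length_lt hV [x, a, a'] (by simp)
  simp only [List.mem_cons, List.not_mem_nil, or_false, not_or] at hp
  obtain ⟨b, b', hpb, hb, ob⟩ := out hp.1
  obtain ⟨q, hq⟩ := exists_notMem_of_length_lt hV [x, a, a', b, b'] (by simp)
  simp only [List.mem_cons, List.not_mem_nil, or_false, not_or] at hq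
  obtain ⟨c, c', hqc, hc, oc⟩ := out hq.1
  have sr := @IsLine.swap_right V _ B
  have n := @IsLine.ne V _ B hS
  have u := @IsLine.unique V _ B hS
  have dis : ∀ {a a' b b' p}, IsLine B x a a' → IsLine B x b b' → p = b ∨ p = b' →
      p ≠ a → p ≠ a' → a ≠ b ∧ a ≠ b' ∧ a' ≠ b ∧ a' ≠ b' := by
    intro a a' b b' p ha hb
    have := sr ha
    have := sr hb
    grind
  have dab := dis ha hb hpb hp.2.1 hp.2.2
  have dac := dis ha hc hqc hq.2.1 hq.2.2.1
  have dbc := dis hb hc hqc hq.2.2.2.1 hq.2.2.2.2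
  have na := n ha
  have nb := n hb
  have nc := n hc
  have l := hr.isLine_of_rel hS oa.1 ob.1 oc.1 dab.1 dac.1 dbc.1
  clear dis out sr n u
  rcases hr.2.1 a b c l with h | h
  · exact ⟨x, a, a', b, b', c, c', by simp; grind, ⟨ha, hb, hc⟩, oa, ob, oc, l, h⟩
  · exact ⟨x, a, a', c, c', b, b', by simp; grind, ⟨ha, hc, hb⟩, oa, oc, ob, l.swap_right, h⟩

theorem IsOrientation.rel_of_transversal (hB : IsFano B) {r : V → V → Prop}
    (hr : IsOrientation B r) {x a a' b b' c c' : V}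
    (hn : [x, a, a', b, b', c, c'].Nodup) (ha : IsLine B x a a') (hb : IsLine B x b b')
    (hc : IsLine B x c c') (h : IsLine B a b c) (haa : r a a') (hab : r a b) :
    r a c' ∧ r c' b' ∧ r b' a := by
  refine (hr.2.1 _ _ _ (IsLine.transversal hB hn ha hb hc h)).resolve_left fun ⟨h1, _⟩ => ?_
  have l1 := hr.isLine_of_rel hB.2 haa h1 hab (by simp at hn; grind) (by simp at hn; grind)
    (by simp at hn; grind)
  have l2 := IsLine.transversal hB (by simp at hn ⊢; grind) hc ha hb h.swap_right.swap_left
  have := l1.unique hB.2 l2.swap_left.swap_right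
  simp at hn
  grind

/-- An oriented Fano plane is isomorphic to the cyclic one oriented by the Paley tournament. -/
theorem exists_equiv_of_isOrientation (hB : IsFano B) {r : V → V → Prop}
    (hr : IsOrientation B r) :
    ∃ E : Fin 7 ≃ V, (∀ i j k, IsLine B (E i) (E j) (E k) ↔ CyclicLine i j k) ∧
      ∀ i j, r (E i) (E j) ↔ Paley i j := by
  obtain ⟨x, a, a', b, b', c, c', hn, ⟨ha, hb, hc⟩, oa, ob, oc, h, oh⟩ :=
    exists_oriented_pencil hB hr
  obtain ⟨E, hE⟩ := exists_equiv_of_nodup hB.1 (a := x) (b := a) (c := b) (d := a') (e := c)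
    (f := c') (g := b') (by simp at hn ⊢; grind)
  have hn' : [x, b, b', c, c', a, a'].Nodup := by simp at hn ⊢; grind
  have hn'' : [x, c, c', a, a', b, b'].Nodup := by simp at hn ⊢; grind
  have h' := h.swap_left.swap_right
  have h'' := h'.swap_left.swap_right
  have ta := IsLine.transversal hB hn ha hb hc h
  have tb := IsLine.transversal hB hn' hb hc ha h'
  have tc := IsLine.transversal hB hn'' hc ha hb h''
  have ra := hr.rel_of_transversal hB hn ha hb hc h oa.2.1 oh.1
  have rb := hr.rel_of_transversal hB hn' hb hc ha h' ob.2.1 oh.2.1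
  have rc := hr.rel_of_transversal hB hn'' hc ha hb h'' oc.2.1 oh.2.2
  have sl := @IsLine.swap_left V _ B
  have sr := @IsLine.swap_right V _ B
  refine ⟨E, isLine_iff_of_forall hB.2 E exists_pair_cyclicLine ?_, ?_⟩
  · intro c
    rw [hE]
    fin_cases c <;> simp <;> grind
  · have key : ∀ i j, Paley i j → r (E i) (E j) := by
      rw [hE]
      intro i j hij
      fin_cases i <;> fin_cases j <;> simp [Paley] at hij ⊢ <;> grind
    refine fun i j => ⟨fun h => ?_, key i j⟩
    by_contra hij
    have : ∀ i j : Fin 7, ¬ Paley i j → i = j ∨ Paley j i := by decide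
    rcases this i j hij with rfl | hji
    · exact hr.1 _ _ h h
    · exact hr.1 _ _ h (key j i hji)

/-- The blocks associated with the Paley tournament. -/
theorem orientBlocks_eq {r : V → V → Prop} (E : Fin 7 ≃ V)
    (hr : ∀ i j, r (E i) (E j) ↔ Paley i j) :
    orientBlocks r = Finset.univ.image fun c : Fin 7 => {E (c + 3), E (c + 5), E (c + 6)} := by
  have key : ∀ c : Fin 7, (Finset.univ.filter fun i => Paley i c) = {c + 3, c + 5, c + 6} := by
    decide
  ext b
  simp only [orientBlocks, Finset.mem_image, Finset.mem_univ, true_and]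
  rw [← E.exists_congr_right]
  refine exists_congr fun c => ?_
  convert Iff.rfl using 2
  ext x
  obtain ⟨i, rfl⟩ := E.surjective x
  simpa [hr] using (Finset.ext_iff.1 (key c) i).symm

theorem isLine_orientBlocks_iff {r : V → V → Prop} (E : Fin 7 ≃ V)
    (hr : ∀ i j, r (E i) (E j) ↔ Paley i j) (i j k : Fin 7) :
    IsLine (orientBlocks r) (E i) (E j) (E k) ↔ CyclicLine' i j k := by
  have : ∀ a b c, ({E a, E b, E c} : Finset V) = ({a, b, c} : Finset (Fin 7)).image E := by simp
  simp only [IsLine, orientBlocks_eq E hr, Finset.mem_image, Finset.mem_univ, true_and, this,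
    (Finset.image_injective E.injective).eq_iff, CyclicLine', eq_comm]

theorem isSteiner_orientBlocks {r : V → V → Prop} (E : Fin 7 ≃ V)
    (hr : ∀ i j, r (E i) (E j) ↔ Paley i j) : IsSteiner (orientBlocks r) := by
  rw [orientBlocks_eq E hr]
  refine ⟨?_, fun x y hxy => ?_⟩
  · simp only [Finset.mem_image, Finset.mem_univ, true_and, forall_exists_index,
      forall_apply_eq_imp_iff]
    intro c
    refine Finset.card_eq_three.2 ⟨_, _, _, ?_, ?_, ?_, rfl⟩ <;> simp
  · obtain ⟨i, rfl⟩ := E.surjective x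
    obtain ⟨j, rfl⟩ := E.surjective y
    have key : ∀ i j : Fin 7, i ≠ j → ∃ c : Fin 7,
        ((i = c + 3 ∨ i = c + 5 ∨ i = c + 6) ∧ (j = c + 3 ∨ j = c + 5 ∨ j = c + 6)) ∧
        ∀ d : Fin 7, (i = d + 3 ∨ i = d + 5 ∨ i = d + 6) →
          (j = d + 3 ∨ j = d + 5 ∨ j = d + 6) → d = c := by decide +kernel
    obtain ⟨c, hc, hu⟩ := key i j (fun e => hxy (congrArg E e))
    refine ⟨{E (c + 3), E (c + 5), E (c + 6)}, ⟨by simp, by simpa using hc⟩, ?_⟩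
    rintro b ⟨hb, hi, hj⟩
    obtain ⟨d, -, rfl⟩ := Finset.mem_image.1 hb
    simp only [Finset.mem_insert, Finset.mem_singleton, E.injective.eq_iff] at hi hj
    rw [hu d hi hj]

/-- An orientation is determined by the pair of planes `B` and `orientBlocks r`. -/
theorem IsOrientation.rel_iff (hB : IsFano B) {r : V → V → Prop} (hr : IsOrientation B r)
    (x y : V) : r x y ↔ ∃ z w, IsLine (orientBlocks r) x z w ∧ y ≠ x ∧ y ≠ z ∧ y ≠ w ∧
      ¬ IsLine B x z y ∧ ¬ IsLine B x w y ∧ ¬ IsLine B z w y := by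
  obtain ⟨E, hE, hP⟩ := exists_equiv_of_isOrientation hB hr
  have key : ∀ i j : Fin 7, Paley i j ↔ ∃ k l, CyclicLine' i k l ∧ j ≠ i ∧ j ≠ k ∧ j ≠ l ∧
      ¬ CyclicLine i k j ∧ ¬ CyclicLine i l j ∧ ¬ CyclicLine k l j := by decide +kernel
  obtain ⟨i, rfl⟩ := E.surjective x
  obtain ⟨j, rfl⟩ := E.surjective y
  simpa only [← E.exists_congr_right, hP, hE, isLine_orientBlocks_iff E hP, E.injective.ne_iff]
    using key i j

end Coordinates

/-- For a fixed Fano plane `B`, the map `r ↦ F_r` is a bijection from the set of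
orientations on `B` onto the set of Fano planes orthogonal to `B`. -/
theorem orientBlocks_bijOn {V : Type*} [DecidableEq V] [Fintype V]
    (B : Finset (Finset V)) (hB : IsFano B) :
    Set.BijOn (fun r : V → V → Prop => orientBlocks r)
      {r : V → V → Prop | IsOrientation B r}
      {B' : Finset (Finset V) | IsFano B' ∧ DisjointSTS B B'} := by
  refine ⟨fun r hr => ?_, fun r hr s hs hrs => ?_, fun B' ⟨hB', hd⟩ => ?_⟩
  · obtain ⟨E, hE, hP⟩ := exists_equiv_of_isOrientation hB hr
    have hS := isSteiner_orientBlocks E hP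
    refine ⟨⟨hB.1, hS⟩, fun b ⟨hb, hb'⟩ => ?_⟩
    obtain ⟨x, y, z, rfl, hl⟩ := exists_eq_of_mem hB.2 hb
    obtain ⟨i, rfl⟩ := E.surjective x
    obtain ⟨j, rfl⟩ := E.surjective y
    obtain ⟨k, rfl⟩ := E.surjective z
    have key : ∀ i j k, CyclicLine i j k → ¬ CyclicLine' i j k := by decide +kernel
    exact key i j k ((hE i j k).1 hl) ((isLine_orientBlocks_iff E hP i j k).1 hb')
  · replace hrs : orientBlocks r = orientBlocks s := hrs
    funext x y
    rw [hr.rel_iff hB, hs.rel_iff hB, hrs]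
  · obtain ⟨E, hE, hE'⟩ := exists_equiv_of_disjoint hB hB' hd
    have hP : ∀ i j, Paley (E.symm (E i)) (E.symm (E j)) ↔ Paley i j := by simp
    refine ⟨fun x y => Paley (E.symm x) (E.symm y), isOrientation_of_equiv E hE hP,
      eq_of_isLine_iff (isSteiner_orientBlocks E hP) hB'.2 ?_⟩
    simp only [← E.forall_congr_right, hE']
    exact isLine_orientBlocks_iff E hP
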